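/- The elliptic pairing e_Γ descends to a positive definite Hermitian inner product on the elliptic quotient Ell(Γ) = G_ℂ(Γ)/Σ_{H∈L} Ind_H^Γ(G_ℂ(H)). -/

import Mathlib

/- STATEMENT 12: the elliptic pairing e_Γ descends to a positive definite
Hermitian inner product on Ell(Γ) = G_ℂ(Γ)/Σ_{H∈L} Ind_H^Γ(G_ℂ(H)). -/

open scoped TensorProduct Classical
open ExteriorAlgebra

noncomputable section

/-- The endomorphism of the `k`-th exterior power induced by an endomorphism. -/
def extPowMap {R M : Type*} [CommRing R] [AddCommGroup M] [Module R M] (k : ℕ)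
    (f : M →ₗ[R] M) : ↥(⋀[R]^k M) →ₗ[R] ↥(⋀[R]^k M) :=
  LinearMap.restrict (ExteriorAlgebra.map f).toLinearMap (p := ⋀[R]^k M)
    (q := ⋀[R]^k M) (by
      intro x hx
      rw [← ιMulti_span_fixedDegree] at hx ⊢
      induction hx using Submodule.span_induction with
      | mem x hx =>
        obtain ⟨m, rfl⟩ := hx
        rw [AlgHom.toLinearMap_apply, map_apply_ιMulti]
        exact Submodule.subset_span ⟨f ∘ m, rfl⟩
      | zero => simp
      | add x y _ _ hx hy => rw [map_add]; exact Submodule.add_mem _ hx hy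
      | smul c x _ hx => rw [map_smul]; exact Submodule.smul_mem _ _ hx)

/-- The space of `Γ`-equivariant linear maps. -/
def equivHom {k A B : Type*} [CommRing k] [AddCommGroup A] [Module k A]
    [AddCommGroup B] [Module k B] {Γ : Type*}
    (a : Γ → A →ₗ[k] A) (b : Γ → B →ₗ[k] B) : Submodule k (A →ₗ[k] B) where
  carrier := {f | ∀ γ : Γ, f ∘ₗ a γ = b γ ∘ₗ f}
  zero_mem' := by intro γ; rw [LinearMap.zero_comp, LinearMap.comp_zero]
  add_mem' := by
    intro f g hf hg γ
    rw [LinearMap.add_comp, LinearMap.comp_add, hf γ, hg γ]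
  smul_mem' := by
    intro c f hf γ
    rw [LinearMap.smul_comp, LinearMap.comp_smul, hf γ]

variable (Γ : Type) [Group Γ] [Fintype Γ]

/-- The space of virtual characters (`G_ℂ(Γ)`). -/
def charSpace : Submodule ℂ (Γ → ℂ) :=
  Submodule.span ℂ {f | ∃ W : FDRep ℂ Γ, f = FDRep.character W}

/-- The induced-character map from a subgroup. -/
def indChar (H : Subgroup Γ) (f : ↥H → ℂ) : Γ → ℂ := fun γ =>
  (Nat.card ↥H : ℂ)⁻¹ *
    ∑ x : Γ, (if h : x⁻¹ * γ * x ∈ H then f ⟨x⁻¹ * γ * x, h⟩ else 0)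

variable {E : Type} [AddCommGroup E] [Module ℝ E] [FiniteDimensional ℝ E]

/-- `Σ_{H ∈ L} Ind_H^Γ(G_ℂ(H))`, for `L` the set of subgroups with
`E^{ρ(H)} ≠ 0`. -/
def indSub (ρ : Representation ℝ Γ E) : Submodule ℂ (Γ → ℂ) :=
  Submodule.span ℂ {f | ∃ H : Subgroup Γ,
    (∃ v : E, v ≠ 0 ∧ ∀ h ∈ H, ρ h v = v) ∧
    ∃ W : FDRep ℂ ↥H, f = indChar Γ H (FDRep.character W)}

theorem aux_eigenbasis {V : Type} [AddCommGroup V] [Module ℂ V] [FiniteDimensional ℂ V]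
    (f : V →ₗ[ℂ] V) (m : ℕ) (hm : 0 < m) (hf : f ^ m = 1) :
    ∃ (b : Module.Basis (Fin (Module.finrank ℂ V)) ℂ V) (μ : Fin (Module.finrank ℂ V) → ℂ),
      (∀ i, f (b i) = μ i • b i) ∧ ∀ i, ‖μ i‖ = 1 := by
  have hss : Module.End.IsSemisimple f := by
    refine Module.End.isSemisimple_of_squarefree_aeval_eq_zero
      (p := (Polynomial.X ^ m - Polynomial.C 1 : Polynomial ℂ)) ?_ ?_
    · exact (Polynomial.separable_X_pow_sub_C (1 : ℂ) (by exact_mod_cast hm.ne') one_ne_zero).squarefree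
    · simp [hf]
  have hint : DirectSum.IsInternal (fun μ : ℂ => Module.End.eigenspace f μ) :=
    DirectSum.isInternal_submodule_of_iSupIndep_of_iSup_eq_top
      (Module.End.eigenspaces_iSupIndep f) hss.iSup_eigenspace_eq_top
  let b0 := hint.collectedBasis (fun μ => Module.finBasis ℂ (Module.End.eigenspace f μ))
  let e := b0.indexEquiv (Module.finBasis ℂ V)
  have h1 : ∀ i, f (b0 i) = i.1 • b0 i := fun i =>
    Module.End.mem_eigenspace_iff.1 (hint.collectedBasis_mem _ i)
  refine ⟨b0.reindex e, fun i => (e.symm i).1, fun i => ?_, fun i => ?_⟩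
  · simpa using h1 _
  · have h2 : ∀ k : ℕ, (f ^ k) (b0 (e.symm i)) = (e.symm i).1 ^ k • b0 (e.symm i) := by
      intro k
      induction k with
      | zero => simp
      | succ k ih => rw [pow_succ', Module.End.mul_apply, ih, map_smul, h1, smul_smul, pow_succ]
    have h3 := h2 m
    rw [hf, Module.End.one_apply] at h3
    have h4 : (e.symm i).1 ^ m = 1 := by
      by_contra hne
      have : ((e.symm i).1 ^ m - 1) • b0 (e.symm i) = 0 := by rw [sub_smul, ← h3]; simp
      rcases smul_eq_zero.1 this with h | h
      · exact hne (sub_eq_zero.1 h)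
      · exact b0.ne_zero _ h
    exact Complex.norm_eq_one_of_pow_eq_one h4 hm.ne'

theorem aux_trace_eigen {ι V : Type*} [Fintype ι] [AddCommGroup V] [Module ℂ V]
    (b : Module.Basis ι ℂ V) (f : V →ₗ[ℂ] V) (μ : ι → ℂ) (h : ∀ i, f (b i) = μ i • b i) :
    LinearMap.trace ℂ V f = ∑ i, μ i := by
  rw [LinearMap.trace_eq_matrix_trace ℂ b, Matrix.trace]
  refine Finset.sum_congr rfl fun i _ => ?_
  simp [LinearMap.toMatrix_apply, h]

theorem aux_det_eigen {ι V : Type*} [Fintype ι] [AddCommGroup V] [Module ℂ V]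
    (b : Module.Basis ι ℂ V) (f : V →ₗ[ℂ] V) (μ : ι → ℂ) (h : ∀ i, f (b i) = μ i • b i) :
    LinearMap.det (1 - f) = ∏ i, (1 - μ i) := by
  rw [← LinearMap.det_toMatrix b]
  have : LinearMap.toMatrix b b (1 - f) = Matrix.diagonal (fun i => 1 - μ i) := by
    ext i j
    by_cases hij : i = j
    · subst hij; simp [LinearMap.toMatrix_apply, h]
    · simp [LinearMap.toMatrix_apply, h, hij]
  rw [this, Matrix.det_diagonal]

theorem aux_conj_trace {V : Type} [AddCommGroup V] [Module ℂ V] [FiniteDimensional ℂ V]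
    (f g : V →ₗ[ℂ] V) (hgf : g * f = 1) (m : ℕ) (hm : 0 < m) (hf : f ^ m = 1) :
    LinearMap.trace ℂ V g = (starRingEnd ℂ) (LinearMap.trace ℂ V f) := by
  obtain ⟨b, μ, h, hn⟩ := aux_eigenbasis f m hm hf
  have hg : ∀ i, g (b i) = (starRingEnd ℂ) (μ i) • b i := by
    intro i
    have h1 : g (f (b i)) = b i := LinearMap.congr_fun hgf (b i)
    rw [h, map_smul] at h1
    have h2 : (starRingEnd ℂ) (μ i) * μ i = 1 := by
      rw [← Complex.normSq_eq_conj_mul_self, Complex.normSq_eq_norm_sq, hn]; simp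
    rw [← one_smul ℂ (g (b i)), ← h2, mul_smul, h1]
  rw [aux_trace_eigen b f μ h, aux_trace_eigen b g _ hg, map_sum]

theorem aux_regzero {Γ : Type} [Group Γ] [Fintype Γ] (c : Γ → ℂ)
    (hc : ∀ g h, c (h * g * h⁻¹) = c g)
    (hW : ∀ W : FDRep ℂ Γ, ∑ g, c g * FDRep.character W g = 0)
    {V : Type} [AddCommGroup V] [Module ℂ V] [FiniteDimensional ℂ V]
    (ρ : Representation ℂ Γ V) : ∑ g, c g • ρ g = 0 := by
  set T : V →ₗ[ℂ] V := ∑ g, c g • ρ g with hT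
  have hcomm : ∀ h, ρ h * T = T * ρ h := by
    intro h
    rw [hT, Finset.mul_sum, Finset.sum_mul]
    refine Fintype.sum_equiv (MulAut.conj h).toEquiv _ _ fun g => ?_
    simp only [MulEquiv.toEquiv_eq_coe, MulEquiv.coe_toEquiv, MulAut.conj_apply, hc,
      mul_smul_comm, smul_mul_assoc, ← map_mul]
    simp [mul_assoc]
  have hcomm' : ∀ h v, T (ρ h v) = ρ h (T v) := fun h v => (LinearMap.congr_fun (hcomm h) v).symm
  have key : ∀ μ : ℂ, Module.End.HasEigenvalue T μ → μ = 0 := by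
    intro μ hμ
    let S : Subrepresentation ρ := ⟨Module.End.eigenspace T μ, fun g v hv => by
      rw [Module.End.mem_eigenspace_iff] at hv ⊢
      rw [hcomm', hv, map_smul]⟩
    have h1 := hW (FDRep.of S.toRepresentation)
    have h2 : ∑ g, c g * FDRep.character (FDRep.of S.toRepresentation) g =
        LinearMap.trace ℂ S.toSubmodule (∑ g, c g • S.toRepresentation g) := by
      rw [map_sum]
      refine Finset.sum_congr rfl fun g _ => ?_
      rw [map_smul]; rfl
    have h3 : ∑ g, c g • S.toRepresentation g = μ • (1 : S.toSubmodule →ₗ[ℂ] S.toSubmodule) := by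
      ext v
      have hv : T v = μ • (v : V) := Module.End.mem_eigenspace_iff.1 v.2
      rw [hT] at hv
      simp only [LinearMap.sum_apply, LinearMap.smul_apply, Module.End.one_apply] at hv ⊢
      rw [Submodule.coe_smul, ← hv, AddSubmonoidClass.coe_finsetSum]
      rfl
    rw [h2, h3, map_smul, LinearMap.trace_one, smul_eq_mul, mul_eq_zero] at h1
    rcases h1 with h | h
    · exact h
    · exfalso
      have h5 : Module.finrank ℂ S.toSubmodule = 0 := by exact_mod_cast h
      exact hμ (Submodule.finrank_eq_zero.1 h5)
  let K : Subrepresentation ρ := ⟨LinearMap.ker T, fun g v hv => by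
      rw [LinearMap.mem_ker] at hv ⊢
      rw [hcomm', hv, map_zero]⟩
  have : NeZero (Nat.card Γ : ℂ) := ⟨by exact_mod_cast Nat.card_pos.ne'⟩
  obtain ⟨Q, hQ⟩ := exists_isCompl K
  have hTQ : ∀ v ∈ Q.toSubmodule, T v ∈ Q.toSubmodule := by
    intro v hv
    rw [hT, LinearMap.sum_apply]
    exact Submodule.sum_mem _ fun g _ => Submodule.smul_mem _ _ (Q.apply_mem_toSubmodule g hv)
  have hQ0 : Q.toSubmodule = ⊥ := by
    by_contra hne
    have : Nontrivial Q.toSubmodule := Submodule.nontrivial_iff_ne_bot.2 hne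
    obtain ⟨μ, hμ⟩ := Module.End.exists_eigenvalue (T.restrict hTQ)
    obtain ⟨v, hv⟩ := hμ.exists_hasEigenvector
    have hv1 : T v = μ • (v : V) := congrArg Subtype.val hv.apply_eq_smul
    have hv0 : (v : V) ≠ 0 := fun h => hv.2 (Subtype.ext h)
    have hμ0 := key μ (Module.End.hasEigenvalue_of_hasEigenvector
      (x := (v : V)) ⟨Module.End.mem_eigenspace_iff.2 hv1, hv0⟩)
    rw [hμ0, zero_smul] at hv1
    have : (v : V) ∈ (K ⊓ Q : Subrepresentation ρ) := ⟨hv1, v.2⟩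
    rw [hQ.inf_eq_bot] at this
    exact hv0 this
  have hK : K = ⊤ := by
    have h := hQ.sup_eq_top
    have : Q = ⊥ := Subrepresentation.toSubmodule_injective hQ0
    rwa [this, sup_bot_eq] at h
  have : LinearMap.ker T = ⊤ := congrArg Subrepresentation.toSubmodule hK
  exact LinearMap.ker_eq_top.1 this

def auxReg (Γ : Type) [Group Γ] : Representation ℂ Γ (Γ → ℂ) where
  toFun g := LinearMap.funLeft ℂ ℂ (fun x => x * g)
  map_one' := by ext; simp [LinearMap.funLeft]
  map_mul' a b := by ext; simp [LinearMap.funLeft, mul_assoc]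

theorem aux_class_zero {Γ : Type} [Group Γ] [Fintype Γ] (c : Γ → ℂ)
    (hc : ∀ g h, c (h * g * h⁻¹) = c g)
    (hW : ∀ W : FDRep ℂ Γ, ∑ g, c g * FDRep.character W g = 0) : c = 0 := by
  have h := aux_regzero c hc hW (auxReg Γ)
  ext g
  have h1 := congrFun (LinearMap.congr_fun h (Pi.single g 1)) 1
  simpa [LinearMap.sum_apply, Finset.sum_apply, auxReg, LinearMap.funLeft, Pi.single_apply] using h1

theorem aux_class_mem {Γ : Type} [Group Γ] [Fintype Γ] (f : Γ → ℂ)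
    (hf : ∀ g h, f (h * g * h⁻¹) = f g) : f ∈ charSpace Γ := by
  by_contra hne
  obtain ⟨φ, hφ0, hφ⟩ := Submodule.exists_le_ker_of_notMem hne
  let d : Γ → ℂ := fun g => φ (Pi.single g 1)
  have hd : ∀ k : Γ → ℂ, φ k = ∑ g, d g * k g := by
    intro k
    conv_lhs => rw [pi_eq_sum_univ' k]
    rw [map_sum]
    refine Finset.sum_congr rfl fun g _ => ?_
    rw [map_smul, smul_eq_mul, mul_comm]
  let c : Γ → ℂ := fun g => ∑ h, d (h * g * h⁻¹)
  have hc : ∀ g h, c (h * g * h⁻¹) = c g := by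
    intro g h
    refine Fintype.sum_equiv (Equiv.mulRight h) _ _ fun x => ?_
    simp [mul_assoc]
  have hs : ∀ k : Γ → ℂ, (∀ g h, k (h * g * h⁻¹) = k g) →
      ∑ g, c g * k g = Fintype.card Γ * φ k := by
    intro k hk
    simp only [c, Finset.sum_mul]
    rw [Finset.sum_comm]
    have : ∀ h : Γ, ∑ g, d (h * g * h⁻¹) * k g = φ k := by
      intro h
      rw [hd]
      refine Fintype.sum_equiv (MulAut.conj h).toEquiv _ _ fun g => ?_
      simp [hk]
    simp [this]
  have hc0 : c = 0 := by
    refine aux_class_zero c hc fun W => ?_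
    rw [hs _ (fun g h => FDRep.char_conj W g h)]
    have : φ (FDRep.character W) = 0 := hφ (Submodule.subset_span ⟨W, rfl⟩)
    rw [this, mul_zero]
  have := hs f hf
  rw [hc0] at this
  simp at this
  exact hφ0 this
theorem aux_extPowMap_ιMulti_family {V : Type} [AddCommGroup V] [Module ℂ V] {n : ℕ}
    (b : Module.Basis (Fin n) ℂ V) (f : V →ₗ[ℂ] V) (μ : Fin n → ℂ)
    (h : ∀ i, f (b i) = μ i • b i) (k : ℕ) (s : Set.powersetCard (Fin n) k) :
    extPowMap k f (b.exteriorPower k s) = (∏ i ∈ s.1, μ i) • b.exteriorPower k s := by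
  apply Subtype.ext
  rw [exteriorPower.basis_apply]
  change ExteriorAlgebra.map f (ExteriorAlgebra.ιMulti ℂ k _) = _ • ExteriorAlgebra.ιMulti ℂ k _
  rw [ExteriorAlgebra.map_apply_ιMulti]
  have : (f ∘ (b ∘ (Set.powersetCard.ofFinEmbEquiv.symm s))) =
      fun i => μ (Set.powersetCard.ofFinEmbEquiv.symm s i) •
        (b ∘ (Set.powersetCard.ofFinEmbEquiv.symm s)) i := by
    ext i; simp [h]
  rw [this, AlternatingMap.map_smul_univ]
  congr 1
  conv_rhs => rw [← Finset.map_orderEmbOfFin_univ s.1 s.2, Finset.prod_map]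
  rfl

theorem aux_sum_ext {V : Type} [AddCommGroup V] [Module ℂ V] {n : ℕ}
    (b : Module.Basis (Fin n) ℂ V) (f : V →ₗ[ℂ] V) (μ : Fin n → ℂ)
    (h : ∀ i, f (b i) = μ i • b i) :
    ∑ k ∈ Finset.range (n + 1), (-1 : ℂ) ^ k * LinearMap.trace ℂ _ (extPowMap k f) =
      LinearMap.det (1 - f) := by
  rw [aux_det_eigen b f μ h]
  have h1 : ∀ k, LinearMap.trace ℂ _ (extPowMap k f) =
      ∑ s ∈ Finset.powersetCard k Finset.univ, ∏ i ∈ s, μ i := by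
    intro k
    rw [aux_trace_eigen (b.exteriorPower k) _ _ (aux_extPowMap_ιMulti_family b f μ h k)]
    refine Finset.sum_bij (fun s _ => s.1) ?_ ?_ ?_ ?_
    · intro s _; simp [Finset.mem_powersetCard]
      try exact s.2
    · intro s _ t _ hst; exact Subtype.ext hst
    · intro t ht; exact ⟨⟨t, (Finset.mem_powersetCard.1 ht).2⟩, Finset.mem_univ _, rfl⟩
    · intro s _; rfl
  have h2 : ∏ i, (1 - μ i) = ∏ i, (1 + (- μ i)) := by simp [sub_eq_add_neg]
  rw [h2, Finset.prod_one_add, Finset.sum_powerset]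
  simp only [Finset.card_univ, Fintype.card_fin]
  refine Finset.sum_congr rfl fun k _ => ?_
  rw [h1, Finset.mul_sum]
  refine Finset.sum_congr rfl fun s hs => ?_
  rw [Finset.prod_neg, (Finset.mem_powersetCard.1 hs).2]

def auxExtRep {Γ V : Type} [Group Γ] [AddCommGroup V] [Module ℂ V] (n : ℕ)
    (σ : Representation ℂ Γ V) : Representation ℂ Γ ↥(⋀[ℂ]^n V) where
  toFun γ := extPowMap n (σ γ)
  map_one' := by
    ext x
    simp [extPowMap, Module.End.one_eq_id]
  map_mul' a b := by
    refine LinearMap.ext fun x => Subtype.ext ?_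
    change ExteriorAlgebra.map (σ (a * b)) x.1 =
      ExteriorAlgebra.map (σ a) (ExteriorAlgebra.map (σ b) x.1)
    rw [map_mul, Module.End.mul_eq_comp, ← ExteriorAlgebra.map_comp_map]
    rfl

theorem aux_equivHom_finrank {Γ A B : Type} [Group Γ] [Fintype Γ] [AddCommGroup A] [Module ℂ A]
    [AddCommGroup B] [Module ℂ B] [FiniteDimensional ℂ A] [FiniteDimensional ℂ B]
    (a : Representation ℂ Γ A) (b : Representation ℂ Γ B) :
    (Module.finrank ℂ ↥(equivHom (fun γ => a γ) (fun γ => b γ)) : ℂ) =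
      (Fintype.card Γ : ℂ)⁻¹ * ∑ γ, a.character γ⁻¹ * b.character γ := by
  have : NeZero (Nat.card Γ : ℂ) := ⟨by exact_mod_cast Nat.card_pos.ne'⟩
  let _ : Invertible (Nat.card Γ : ℂ) := invertibleOfNonzero (NeZero.ne _)
  have h := Representation.card_inv_mul_sum_char_eq_finrank (Representation.linHom a b)
  simp only [Representation.char_linHom, Nat.card_eq_fintype_card] at h
  rw [h]
  have : equivHom (fun γ => a γ) (fun γ => b γ) = (Representation.linHom a b).invariants := by
    ext f
    rw [Representation.mem_invariants]
    change (∀ γ, f ∘ₗ a γ = b γ ∘ₗ f) ↔ _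
    refine forall_congr' fun γ => ?_
    rw [Representation.linHom_apply]
    constructor
    · intro h
      rw [← LinearMap.comp_assoc, ← h, LinearMap.comp_assoc]
      rw [← Module.End.mul_eq_comp, ← map_mul]; simp [Module.End.one_eq_id]
    · intro h
      conv_lhs => rw [← h]
      rw [LinearMap.comp_assoc, LinearMap.comp_assoc, ← Module.End.mul_eq_comp (a γ⁻¹), ← map_mul]
      simp [Module.End.one_eq_id]
  rw [this]

theorem aux_det_nonneg {E : Type} [AddCommGroup E] [Module ℝ E] [FiniteDimensional ℝ E]
    (f : E →ₗ[ℝ] E) (m : ℕ) (hm : 0 < m) (hf : f ^ m = 1) : 0 ≤ LinearMap.det (1 - f) := by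
  by_contra hlt
  push Not at hlt
  have hcont : Continuous fun t : ℝ => LinearMap.det (1 - t • f) := by
    have b := Module.finBasis ℝ E
    simp only [← LinearMap.det_toMatrix b, map_sub, map_smul]
    fun_prop
  have h1 : LinearMap.det (1 - (1 : ℝ) • f) < 0 := by simpa using hlt
  obtain ⟨t, ht, ht0⟩ := intermediate_value_Icc' (zero_le_one (α := ℝ)) hcont.continuousOn
    (show (0 : ℝ) ∈ Set.Icc _ _ from ⟨h1.le, by simp⟩)
  have ht1 : t ≠ 1 := by
    rintro rfl
    exact h1.ne ht0
  obtain ⟨v, hv, hv0⟩ := (Submodule.ne_bot_iff _).1 (LinearMap.bot_lt_ker_of_det_eq_zero ht0).ne'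
  have hv1 : t • f v = v := by
    rw [LinearMap.mem_ker] at hv
    exact (sub_eq_zero.1 hv).symm
  have h2 : ∀ k : ℕ, t ^ k • (f ^ k) v = v := by
    intro k
    induction k with
    | zero => simp
    | succ k ih =>
      rw [pow_succ f k, Module.End.mul_apply, pow_succ, mul_smul, ← (f ^ k).map_smul, hv1, ih]
  have h3 := h2 m
  rw [hf, Module.End.one_apply] at h3
  have h4 : (t ^ m - 1) • v = 0 := by rw [sub_smul, h3]; simp
  rcases smul_eq_zero.1 h4 with h | h
  · have : t ^ m < 1 := pow_lt_one₀ ht.1 (lt_of_le_of_ne ht.2 ht1) hm.ne'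
    linarith
  · exact hv0 h

theorem aux_det_zero {E : Type} [AddCommGroup E] [Module ℝ E] [FiniteDimensional ℝ E]
    (f : E →ₗ[ℝ] E) : LinearMap.det (1 - f) = 0 ↔ ∃ v, v ≠ 0 ∧ f v = v := by
  constructor
  · intro h
    obtain ⟨v, hv, hv0⟩ := (Submodule.ne_bot_iff _).1 (LinearMap.bot_lt_ker_of_det_eq_zero h).ne'
    refine ⟨v, hv0, ?_⟩
    rw [LinearMap.mem_ker] at hv
    exact (sub_eq_zero.1 hv).symm
  · rintro ⟨v, hv0, hv⟩
    by_contra hne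
    have h1 : (1 - f) v = 0 := by simp [hv]
    have h3 : (LinearMap.equivOfDetNeZero (1 - f) hne) v = 0 := h1
    exact hv0 ((LinearEquiv.map_eq_zero_iff _).1 h3)

theorem aux_det_baseChange {E : Type} [AddCommGroup E] [Module ℝ E] [FiniteDimensional ℝ E]
    (f : E →ₗ[ℝ] E) : LinearMap.det (1 - LinearMap.baseChange ℂ f) =
      ((LinearMap.det (1 - f) : ℝ) : ℂ) := by
  have := LinearMap.det_baseChange (A := ℂ) (1 - f)
  rw [LinearMap.baseChange_sub] at this
  have h1 : LinearMap.baseChange ℂ (1 : E →ₗ[ℝ] E) = 1 := by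
    simp [Module.End.one_eq_id]
  rw [h1] at this
  rw [this]; rfl

theorem aux_indChar_conj {Γ : Type} [Group Γ] [Fintype Γ] (H : Subgroup Γ) (f : ↥H → ℂ) (g h : Γ) :
    indChar Γ H f (h * g * h⁻¹) = indChar Γ H f g := by
  let F : Γ → ℂ := fun y => if hy : y ∈ H then f ⟨y, hy⟩ else 0
  change _ * ∑ x, F (x⁻¹ * (h * g * h⁻¹) * x) = _ * ∑ x, F (x⁻¹ * g * x)
  congr 1
  refine Fintype.sum_equiv (Equiv.mulLeft h⁻¹) _ _ fun x => ?_
  simp [mul_assoc]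

theorem aux_indChar_mem {Γ : Type} [Group Γ] [Fintype Γ] {E : Type} [AddCommGroup E] [Module ℝ E]
    (ρ : Representation ℝ Γ E) (H : Subgroup Γ) (hH : ∃ v : E, v ≠ 0 ∧ ∀ h ∈ H, ρ h v = v)
    (f : ↥H → ℂ) (hf : f ∈ charSpace ↥H) : indChar Γ H f ∈ indSub Γ ρ := by
  induction hf using Submodule.span_induction with
  | mem x hx =>
    obtain ⟨W, rfl⟩ := hx
    exact Submodule.subset_span ⟨H, hH, W, rfl⟩
  | zero =>
    have : indChar Γ H 0 = 0 := by ext γ; simp [indChar]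
    rw [this]; exact Submodule.zero_mem _
  | add x y _ _ hx hy =>
    have : indChar Γ H (x + y) = indChar Γ H x + indChar Γ H y := by
      ext γ
      simp only [indChar, Pi.add_apply, ← mul_add, ← Finset.sum_add_distrib]
      congr 1
      refine Finset.sum_congr rfl fun z _ => ?_
      split_ifs <;> simp
    rw [this]; exact Submodule.add_mem _ hx hy
  | smul c x _ hx =>
    have : indChar Γ H (c • x) = c • indChar Γ H x := by
      ext γ
      simp only [indChar, Pi.smul_apply, smul_eq_mul]
      rw [mul_left_comm c, Finset.mul_sum _ _ c]
      congr 1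
      refine Finset.sum_congr rfl fun z _ => ?_
      split_ifs <;> simp
    rw [this]; exact Submodule.smul_mem _ _ hx

theorem aux_charSpace_conj {Γ : Type} [Group Γ] [Fintype Γ] (f : Γ → ℂ) (hf : f ∈ charSpace Γ)
    (g h : Γ) : f (h * g * h⁻¹) = f g := by
  induction hf using Submodule.span_induction with
  | mem x hx => obtain ⟨W, rfl⟩ := hx; exact FDRep.char_conj W g h
  | zero => rfl
  | add x y _ _ hx hy => simp [hx, hy]
  | smul c x _ hx => simp [hx]

/-- The value `det (1 - ρ(γ⁻¹))`. -/
def auxD {Γ : Type} [Group Γ] {E : Type} [AddCommGroup E] [Module ℝ E]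
    (ρ : Representation ℝ Γ E) (γ : Γ) : ℝ := LinearMap.det (1 - ρ γ⁻¹)

theorem auxD_zero {Γ : Type} [Group Γ] {E : Type} [AddCommGroup E] [Module ℝ E]
    [FiniteDimensional ℝ E] (ρ : Representation ℝ Γ E) (γ : Γ) :
    auxD ρ γ = 0 ↔ ∃ v, v ≠ 0 ∧ ρ γ v = v := by
  rw [auxD, aux_det_zero]
  refine exists_congr fun v => and_congr_right fun _ => ?_
  constructor
  · intro h
    conv_lhs => rw [← h]
    simp
  · intro h
    conv_lhs => rw [← h]
    simp

theorem aux_rep_pow {k Γ V : Type} [Field k] [Group Γ] [Fintype Γ] [AddCommGroup V] [Module k V]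
    (ρ : Representation k Γ V) (γ : Γ) : ρ γ ^ Fintype.card Γ = 1 := by
  rw [← map_pow, pow_card_eq_one, map_one]

theorem auxD_nonneg {Γ : Type} [Group Γ] [Fintype Γ] {E : Type} [AddCommGroup E] [Module ℝ E]
    [FiniteDimensional ℝ E] (ρ : Representation ℝ Γ E) (γ : Γ) : 0 ≤ auxD ρ γ :=
  aux_det_nonneg _ _ Fintype.card_pos (aux_rep_pow ρ γ⁻¹)

theorem aux_indSub {Γ : Type} [Group Γ] [Fintype Γ] {E : Type} [AddCommGroup E] [Module ℝ E]
    [FiniteDimensional ℝ E] (ρ : Representation ℝ Γ E) (f : Γ → ℂ) (hf : f ∈ indSub Γ ρ) :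
    f ∈ charSpace Γ ∧ ∀ γ, auxD ρ γ ≠ 0 → f γ = 0 := by
  induction hf using Submodule.span_induction with
  | mem x hx =>
    obtain ⟨H, ⟨v, hv0, hv⟩, W, rfl⟩ := hx
    refine ⟨aux_class_mem _ (aux_indChar_conj H _), fun γ hγ => ?_⟩
    rw [indChar]
    refine mul_eq_zero_of_right _ (Finset.sum_eq_zero fun x _ => ?_)
    rw [dif_neg]
    intro hx
    refine hγ ((auxD_zero ρ γ).2 ⟨ρ x v, ?_, ?_⟩)
    · intro h
      apply hv0
      have := congrArg (ρ x⁻¹) h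
      simpa using this
    · have := congrArg (ρ x) (hv _ hx)
      simp only [← Module.End.mul_apply, ← map_mul] at this ⊢
      simpa [mul_assoc] using this
  | zero => exact ⟨Submodule.zero_mem _, fun _ _ => rfl⟩
  | add x y _ _ hx hy =>
    exact ⟨Submodule.add_mem _ hx.1 hy.1, fun γ h => by simp [hx.2 γ h, hy.2 γ h]⟩
  | smul c x _ hx => exact ⟨Submodule.smul_mem _ _ hx.1, fun γ h => by simp [hx.2 γ h]⟩

theorem aux_mem_indSub {Γ : Type} [Group Γ] [Fintype Γ] {E : Type} [AddCommGroup E] [Module ℝ E]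
    [FiniteDimensional ℝ E] (ρ : Representation ℝ Γ E) (f : Γ → ℂ) (hf : f ∈ charSpace Γ)
    (h0 : ∀ γ, auxD ρ γ ≠ 0 → f γ = 0) : f ∈ indSub Γ ρ := by
  have key : ∀ γ, f γ ≠ 0 → (fun y => ∑ x : Γ, if x⁻¹ * y * x = γ then (1 : ℂ) else 0) ∈
      indSub Γ ρ := by
    intro γ hγ
    have hd : auxD ρ γ = 0 := by
      by_contra h
      exact hγ (h0 γ h)
    obtain ⟨v, hv0, hv⟩ := (auxD_zero ρ γ).1 hd
    let H := Subgroup.zpowers γ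
    have hH : ∀ h ∈ H, ρ h v = v := by
      intro h hh
      let S : Subgroup Γ :=
        { carrier := {g | ρ g v = v}
          mul_mem' := fun {a b} ha hb => by
            change ρ (a * b) v = v
            rw [map_mul, Module.End.mul_apply, show ρ b v = v from hb, show ρ a v = v from ha]
          one_mem' := by simp
          inv_mem' := fun {a} ha => by
            change ρ a⁻¹ v = v
            conv_lhs => rw [← show ρ a v = v from ha]
            simp }
      have : H ≤ S := (Subgroup.zpowers_le (H := S)).2 hv
      exact this hh
    let δ : ↥H → ℂ := fun y => if (y : Γ) = γ then 1 else 0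
    have hδ : δ ∈ charSpace ↥H := by
      refine aux_class_mem _ fun g h => ?_
      have : h * g * h⁻¹ = g := by
        rw [mul_comm' h g]; simp
      rw [this]
    have h1 := aux_indChar_mem ρ H ⟨v, hv0, hH⟩ δ hδ
    have h2 := Submodule.smul_mem _ (Nat.card ↥H : ℂ) h1
    convert h2 using 1
    ext y
    have hc : (Nat.card ↥H : ℂ) ≠ 0 := by exact_mod_cast Nat.card_pos.ne'
    simp only [indChar, Pi.smul_apply, smul_eq_mul, mul_inv_cancel_left₀ hc]
    refine Finset.sum_congr rfl fun x _ => ?_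
    by_cases hx : x⁻¹ * y * x = γ
    · have : x⁻¹ * y * x ∈ H := by rw [hx]; exact Subgroup.mem_zpowers γ
      rw [dif_pos this]
    · rw [if_neg hx]
      simp [hx, δ]
  have hsum : f = (Fintype.card Γ : ℂ)⁻¹ • ∑ γ, f γ •
      (fun y => ∑ x : Γ, if x⁻¹ * y * x = γ then (1 : ℂ) else 0) := by
    ext y
    simp only [Pi.smul_apply, Finset.sum_apply, smul_eq_mul]
    rw [Finset.sum_congr rfl fun γ _ => Finset.mul_sum _ _ (f γ), Finset.sum_comm]
    have : ∀ x : Γ, ∑ γ, f γ * (if x⁻¹ * y * x = γ then (1 : ℂ) else 0) = f y := by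
      intro x
      have := aux_charSpace_conj f hf y x⁻¹
      rw [inv_inv] at this
      simp [this]
    rw [Finset.sum_congr rfl fun x _ => this x]
    simp
  rw [hsum]
  refine Submodule.smul_mem _ _ (Submodule.sum_mem _ fun γ _ => ?_)
  by_cases hγ : f γ = 0
  · rw [hγ, zero_smul]; exact Submodule.zero_mem _
  · exact Submodule.smul_mem _ _ (key γ hγ)

theorem aux_form {Γ : Type} [Group Γ] [Fintype Γ] {E : Type} [AddCommGroup E] [Module ℝ E]
    [FiniteDimensional ℝ E] (ρ : Representation ℝ Γ E) (U V : FDRep ℂ Γ) :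
    ∑ n ∈ Finset.range (Module.finrank ℝ E + 1), (-1 : ℂ) ^ n *
          (Module.finrank ℂ
            ↥(equivHom
              (fun γ => TensorProduct.map (U.ρ γ)
                (extPowMap n (LinearMap.baseChange ℂ (ρ γ))))
              (fun γ => V.ρ γ)) : ℂ) =
    (Fintype.card Γ : ℂ)⁻¹ * ∑ γ, (starRingEnd ℂ) (FDRep.character U γ) * FDRep.character V γ *
      (auxD ρ γ : ℂ) := by
  let σ : Representation ℂ Γ (ℂ ⊗[ℝ] E) :=
    { toFun := fun γ => LinearMap.baseChange ℂ (ρ γ)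
      map_one' := by simp [Module.End.one_eq_id]
      map_mul' := fun a b => by rw [map_mul, LinearMap.baseChange_mul] }
  have h1 : ∀ n, (Module.finrank ℂ
            ↥(equivHom
              (fun γ => TensorProduct.map (U.ρ γ)
                (extPowMap n (LinearMap.baseChange ℂ (ρ γ))))
              (fun γ => V.ρ γ)) : ℂ) = (Fintype.card Γ : ℂ)⁻¹ * ∑ γ,
              (FDRep.character U γ⁻¹ * LinearMap.trace ℂ _ (extPowMap n (σ γ⁻¹))) *
                FDRep.character V γ := by
    intro n
    have := aux_equivHom_finrank (Representation.tprod U.ρ (auxExtRep n σ)) V.ρ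
    rw [Representation.char_tensor] at this
    exact this
  have h2 : ∀ γ, ∑ n ∈ Finset.range (Module.finrank ℝ E + 1), (-1 : ℂ) ^ n *
      LinearMap.trace ℂ _ (extPowMap n (σ γ⁻¹)) = (auxD ρ γ : ℂ) := by
    intro γ
    obtain ⟨b, μ, h, -⟩ := aux_eigenbasis (σ γ⁻¹) _ Fintype.card_pos (aux_rep_pow σ γ⁻¹)
    have := aux_sum_ext b (σ γ⁻¹) μ h
    rw [Module.finrank_baseChange] at this
    rw [this]
    exact aux_det_baseChange (ρ γ⁻¹)
  have h3 : ∀ γ, FDRep.character U γ⁻¹ = (starRingEnd ℂ) (FDRep.character U γ) := by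
    intro γ
    refine aux_conj_trace (U.ρ γ) (U.ρ γ⁻¹) ?_ _ Fintype.card_pos (aux_rep_pow U.ρ γ)
    rw [← map_mul]; simp
  simp only [h1, ← h2, Finset.mul_sum, ← h3]
  rw [Finset.sum_comm]
  refine Finset.sum_congr rfl fun γ _ => Finset.sum_congr rfl fun n _ => ?_
  ring

/-- The elliptic pairing
`e_Γ(U,V) = Σ_n (-1)^n dim Hom_Γ(U ⊗ ΛⁿE, V)`, extended sesquilinearly to a
pairing `B` on virtual characters, descends to the elliptic quotient
`Ell(Γ) = G_ℂ(Γ)/Σ_{H∈L} Ind_H^Γ(G_ℂ(H))` and induces there a positive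
definite Hermitian inner product. -/
theorem elliptic_pairing_descends_posdef (ρ : Representation ℝ Γ E)
    (B : (Γ → ℂ) → (Γ → ℂ) → ℂ)
    (hadd₁ : ∀ f f' g, B (f + f') g = B f g + B f' g)
    (hadd₂ : ∀ f g g', B f (g + g') = B f g + B f g')
    (hsmul₁ : ∀ (c : ℂ) f g, B (c • f) g = (starRingEnd ℂ) c * B f g)
    (hsmul₂ : ∀ (c : ℂ) f g, B f (c • g) = c * B f g)
    (hchar : ∀ U V : FDRep ℂ Γ,
      B (FDRep.character U) (FDRep.character V) =
        ∑ n ∈ Finset.range (Module.finrank ℝ E + 1), (-1 : ℂ) ^ n *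
          (Module.finrank ℂ
            ↥(equivHom
              (fun γ => TensorProduct.map (U.ρ γ)
                (extPowMap n (LinearMap.baseChange ℂ (ρ γ))))
              (fun γ => V.ρ γ)) : ℂ)) :
    (∀ f ∈ indSub Γ ρ, ∀ g ∈ charSpace Γ, B f g = 0 ∧ B g f = 0) ∧
    (∀ f ∈ charSpace Γ, ∀ g ∈ charSpace Γ, B g f = (starRingEnd ℂ) (B f g)) ∧
    (∀ f ∈ charSpace Γ, (B f f).im = 0 ∧ 0 ≤ (B f f).re ∧
      (B f f = 0 → f ∈ indSub Γ ρ)) := by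
  have hform : ∀ f ∈ charSpace Γ, ∀ g ∈ charSpace Γ, B f g =
      (Fintype.card Γ : ℂ)⁻¹ * ∑ γ, (starRingEnd ℂ) (f γ) * g γ * (auxD ρ γ : ℂ) := by
    intro f hf g hg
    induction hf using Submodule.span_induction with
    | mem x hx =>
      obtain ⟨U, rfl⟩ := hx
      induction hg using Submodule.span_induction with
      | mem y hy =>
        obtain ⟨V, rfl⟩ := hy
        rw [hchar, aux_form]
      | zero =>
        have := hsmul₂ 0 (FDRep.character U) 0
        rw [zero_smul, zero_mul] at this
        simp [this]
      | add x y _ _ hx hy =>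
        rw [hadd₂, hx, hy, ← mul_add, ← Finset.sum_add_distrib]
        congr 1
        refine Finset.sum_congr rfl fun γ _ => ?_
        simp only [Pi.add_apply]; ring
      | smul c x _ hx =>
        rw [hsmul₂, hx, mul_left_comm, Finset.mul_sum _ _ c]
        congr 1
        refine Finset.sum_congr rfl fun γ _ => ?_
        simp only [Pi.smul_apply, smul_eq_mul]; ring
    | zero =>
      have := hsmul₁ 0 0 g
      rw [zero_smul, map_zero, zero_mul] at this
      simp [this]
    | add x y _ _ hx hy =>
      rw [hadd₁, hx, hy, ← mul_add, ← Finset.sum_add_distrib]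
      congr 1
      refine Finset.sum_congr rfl fun γ _ => ?_
      simp only [Pi.add_apply, map_add]; ring
    | smul c x _ hx =>
      rw [hsmul₁, hx, mul_left_comm, Finset.mul_sum _ _ ((starRingEnd ℂ) c)]
      congr 1
      refine Finset.sum_congr rfl fun γ _ => ?_
      simp only [Pi.smul_apply, smul_eq_mul, map_mul]; ring
  refine ⟨fun f hf g hg => ?_, fun f hf g hg => ?_, fun f hf => ?_⟩
  · obtain ⟨hfc, hf0⟩ := aux_indSub ρ f hf
    rw [hform f hfc g hg, hform g hg f hfc]
    constructor
    · refine mul_eq_zero_of_right _ (Finset.sum_eq_zero fun γ _ => ?_)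
      by_cases h : auxD ρ γ = 0
      · simp [h]
      · simp [hf0 γ h]
    · refine mul_eq_zero_of_right _ (Finset.sum_eq_zero fun γ _ => ?_)
      by_cases h : auxD ρ γ = 0
      · simp [h]
      · simp [hf0 γ h]
  · rw [hform f hf g hg, hform g hg f hf]
    simp only [map_mul, map_sum, map_inv₀, map_natCast, Complex.conj_conj, Complex.conj_ofReal]
    congr 1
    refine Finset.sum_congr rfl fun γ _ => ?_
    ring
  · have hB : B f f = (((Fintype.card Γ : ℝ)⁻¹ * ∑ γ, ‖f γ‖ ^ 2 * auxD ρ γ : ℝ) : ℂ) := by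
      rw [hform f hf f hf]
      push_cast
      congr 1
      refine Finset.sum_congr rfl fun γ _ => ?_
      rw [← Complex.conj_mul']
    have hnn : ∀ γ ∈ Finset.univ, 0 ≤ ‖f γ‖ ^ 2 * auxD ρ γ :=
      fun γ _ => mul_nonneg (sq_nonneg _) (auxD_nonneg ρ γ)
    rw [hB]
    refine ⟨Complex.ofReal_im _, ?_, fun h => ?_⟩
    · rw [Complex.ofReal_re]
      exact mul_nonneg (by positivity) (Finset.sum_nonneg hnn)
    · have h1 := Complex.ofReal_eq_zero.1 h
      have hc : (Fintype.card Γ : ℝ)⁻¹ ≠ 0 := inv_ne_zero (by exact_mod_cast Fintype.card_ne_zero)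
      have h2 := (mul_eq_zero.1 h1).resolve_left hc
      rw [Finset.sum_eq_zero_iff_of_nonneg hnn] at h2
      refine aux_mem_indSub ρ f hf fun γ hγ => ?_
      have h3 := (mul_eq_zero.1 (h2 γ (Finset.mem_univ _))).resolve_right hγ
      simpa using h3

end
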